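/- Fix a natural number N and define the twist-1 Baxter polynomial Q_N : ℂ → ℂ by Q_N(u) = Σ_{k=0}^{N} 2^k · (−N)_k · (i·u + 1/2)_k / (k!)², i.e. the terminating hypergeometric series ₂F₁(−N, i·u+1/2; 1; 2). Then for every u ∈ ℂ, (u + i/2)·Q_N(u + i) − (u − i/2)·Q_N(u − i) = i·(2N+1)·Q_N(u). -/

import Mathlib

/-- Twist-1 Baxter polynomial `Q_N(u) = ₂F₁(−N, i·u+1/2; 1; 2)
 = Σ_{k=0}^{N} 2^k (−N)_k (i·u+1/2)_k / (k!)²`. -/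
noncomputable def baxterQ1 (N : ℕ) (u : ℂ) : ℂ :=
  ∑ k ∈ Finset.range (N + 1),
    2 ^ k * (ascPochhammer ℂ k).eval (-(N : ℂ)) *
      (ascPochhammer ℂ k).eval (Complex.I * u + 1 / 2) / ((k.factorial : ℂ)) ^ 2

theorem ascPochhammer_eval_succ_left (n : ℕ) (b : ℂ) :
    (ascPochhammer ℂ (n + 1)).eval b = b * (ascPochhammer ℂ n).eval (b + 1) := by
  simp [ascPochhammer_succ_left, Polynomial.eval_comp]

/-- Partial sums of the contiguous relation in `b` of `₂F₁(a, b; 1; 2)`. -/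
theorem sum_contiguous_relation (a b : ℂ) (n : ℕ) :
    ∑ k ∈ Finset.range (n + 1),
      2 ^ k * (ascPochhammer ℂ k).eval a / (k.factorial : ℂ) ^ 2 *
        (b * (ascPochhammer ℂ k).eval (b + 1) - (b - 1) * (ascPochhammer ℂ k).eval (b - 1)
          - (1 - 2 * a) * (ascPochhammer ℂ k).eval b)
      = 2 ^ (n + 1) * (ascPochhammer ℂ (n + 1)).eval a * (ascPochhammer ℂ n).eval b
        / (n.factorial : ℂ) ^ 2 := by
  induction n with
  | zero => simp
  | succ n ih =>
    have hf : (n.factorial : ℂ) ≠ 0 := by exact_mod_cast n.factorial_ne_zero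
    have hn : (n : ℂ) + 1 ≠ 0 := by exact_mod_cast n.succ_ne_zero
    rw [Finset.sum_range_succ, ih, ← ascPochhammer_eval_succ_left,
      ascPochhammer_eval_succ_left n (b - 1), sub_add_cancel, Nat.factorial_succ]
    simp only [ascPochhammer_succ_eval]
    push_cast
    field_simp
    ring

/-- The twist-1 leading-order Baxter equation:
`(u + i/2)·Q_N(u + i) − (u − i/2)·Q_N(u − i) = i·(2N+1)·Q_N(u)`. -/
theorem twist1_baxter_equation (N : ℕ) (u : ℂ) :
    (u + Complex.I / 2) * baxterQ1 N (u + Complex.I)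
      - (u - Complex.I / 2) * baxterQ1 N (u - Complex.I)
      = Complex.I * (2 * (N : ℂ) + 1) * baxterQ1 N u := by
  have h := sum_contiguous_relation (-(N : ℂ)) (Complex.I * u + 1 / 2) N
  rw [ascPochhammer_succ_eval N (-(N : ℂ)), neg_add_cancel, mul_zero, mul_zero, zero_mul,
    zero_div] at h
  have h_up : Complex.I * (u + Complex.I) + 1 / 2 = Complex.I * u + 1 / 2 - 1 := by
    linear_combination Complex.I_mul_I
  have h_down : Complex.I * (u - Complex.I) + 1 / 2 = Complex.I * u + 1 / 2 + 1 := by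
    linear_combination -Complex.I_mul_I
  rw [← sub_eq_zero, ← mul_zero Complex.I, ← h]
  simp only [baxterQ1, h_up, h_down, Finset.mul_sum, ← Finset.sum_sub_distrib]
  refine Finset.sum_congr rfl fun k _ => ?_
  generalize (ascPochhammer ℂ k).eval (Complex.I * u + 1 / 2 - 1) = p
  generalize (ascPochhammer ℂ k).eval (Complex.I * u + 1 / 2 + 1) = q
  linear_combination (2 ^ k * (ascPochhammer ℂ k).eval (-(N : ℂ)) / (k.factorial : ℂ) ^ 2 *
    u * (p - q)) * Complex.I_mul_I
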